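/- (Proposition 2.1, in the quantitative form delivered by its proof.) Let α ∈ (0,1) and define K_D(α) as the supremum, over h ∈ (0,1) and over nonconstant functions f ∈ S(α), of the ratio ω(D^α[f], h) / ∫_0^h ω(f,t) t^{−1−α} dt, where the moduli of continuity are taken over (0,1). Then K_D(α) ≥ 1/Γ(1−α); more precisely, for every β ∈ (α,1] the test function f(x) = x^β belongs to S(α) and yields the ratio Γ(1+β)/Γ(β−α) for every h ∈ (0,1), and the supremum of these ratios over β ∈ (α,1] equals 1/Γ(1−α). -/

import Mathlib

open MeasureTheory Set

/-- Modulus of continuity of `g` over the set `X`: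
`ω(g,h) = sup {|g x - g y| : x, y ∈ X, |x - y| ≤ h}`. -/
noncomputable def omegaOn (X : Set ℝ) (g : ℝ → ℝ) (h : ℝ) : ℝ :=
  sSup {v | ∃ x ∈ X, ∃ y ∈ X, |x - y| ≤ h ∧ v = |g x - g y|}

/-- Riemann–Liouville fractional derivative of order `α`:
`D^α[g](x) = (1/Γ(1-α)) * (d/dx) ∫_0^x g(t) (x-t)^(-α) dt`. -/
noncomputable def RLderiv (α : ℝ) (g : ℝ → ℝ) (x : ℝ) : ℝ :=
  (1 / Real.Gamma (1 - α)) * deriv (fun s => ∫ t in (0:ℝ)..s, g t * (s - t) ^ (-α)) x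

/-- The class `S(α)`: continuous functions on `(0,1)` with `f(0+) = 0` and
`∫_0^h ω(f,t) t^(-1-α) dt < ∞` for all `h ∈ (0,1)`. -/
def Sset (α : ℝ) : Set (ℝ → ℝ) :=
  {f | ContinuousOn f (Set.Ioo 0 1) ∧
       Filter.Tendsto f (nhdsWithin 0 (Set.Ioi 0)) (nhds 0) ∧
       ∀ h ∈ Set.Ioo (0:ℝ) 1,
         IntervalIntegrable (fun t => omegaOn (Set.Ioo 0 1) f t * t ^ (-1 - α)) volume 0 h}

/-- The optimal constant `K_D(α)`: the supremum over `h ∈ (0,1)` and nonconstant `f ∈ S(α)`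
of the ratio `ω(D^α[f],h) / ∫_0^h ω(f,t) t^(-1-α) dt`. -/
noncomputable def KD (α : ℝ) : ℝ :=
  sSup {r | ∃ h ∈ Set.Ioo (0:ℝ) 1, ∃ f ∈ Sset α,
    (¬ ∃ c : ℝ, ∀ x ∈ Set.Ioo (0:ℝ) 1, f x = c) ∧
    r = omegaOn (Set.Ioo 0 1) (RLderiv α f) h
          / ∫ t in (0:ℝ)..h, omegaOn (Set.Ioo 0 1) f t * t ^ (-1 - α)}

lemma omegaOn_rpow (γ : ℝ) (h0 : 0 < γ) (h1 : γ ≤ 1) (h : ℝ) (hh : h ∈ Ioo (0:ℝ) 1) (c : ℝ)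
    (hc : 0 ≤ c) (g : ℝ → ℝ) (hg : ∀ x ∈ Ioo (0:ℝ) 1, g x = c * x ^ γ) :
    omegaOn (Ioo 0 1) g h = c * h ^ γ := by
  have key : ∀ x y : ℝ, 0 < y → y ≤ x → x - y ≤ h → c * x ^ γ - c * y ^ γ ≤ c * h ^ γ := by
    intro x y hy hyx hxy
    have e := Real.rpow_add_le_add_rpow (sub_nonneg.2 hyx) hy.le h0.le h1
    rw [sub_add_cancel] at e
    have e2 : (x - y) ^ γ ≤ h ^ γ := Real.rpow_le_rpow (sub_nonneg.2 hyx) hxy h0.le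
    have := mul_le_mul_of_nonneg_left (e.trans (add_le_add_left e2 _)) hc
    nlinarith
  have mono : ∀ x y : ℝ, 0 < y → y ≤ x → c * y ^ γ ≤ c * x ^ γ := fun x y hy hyx =>
    mul_le_mul_of_nonneg_left (Real.rpow_le_rpow hy.le hyx h0.le) hc
  have hub : ∀ v ∈ {v | ∃ x ∈ Ioo (0:ℝ) 1, ∃ y ∈ Ioo (0:ℝ) 1, |x - y| ≤ h ∧ v = |g x - g y|},
      v ≤ c * h ^ γ := by
    rintro v ⟨x, hx, y, hy, hxy, rfl⟩
    rw [hg x hx, hg y hy]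
    rw [abs_le] at hxy ⊢
    rcases le_total x y with hle | hle
    · have := key y x hx.1 hle (by linarith)
      have := mono y x hx.1 hle
      constructor <;> nlinarith [hxy.1]
    · have := key x y hy.1 hle (by linarith)
      have := mono x y hy.1 hle
      constructor <;> nlinarith [hxy.1]
  apply le_antisymm
  · exact Real.sSup_le hub (mul_nonneg hc (Real.rpow_nonneg hh.1.le _))
  · have ht : Filter.Tendsto (fun e : ℝ => c * (h + e) ^ γ - c * e ^ γ) (nhdsWithin 0 (Ioi 0))
        (nhds (c * h ^ γ)) := by
      have : ContinuousAt (fun e : ℝ => c * (h + e) ^ γ - c * e ^ γ) 0 := by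
        apply ContinuousAt.sub
        · apply ContinuousAt.mul continuousAt_const
          apply ContinuousAt.rpow_const (by fun_prop) (Or.inr h0.le)
        · apply ContinuousAt.mul continuousAt_const
          exact Real.continuousAt_rpow_const _ _ (Or.inr h0.le)
      have h2 := this.tendsto
      simp only [add_zero, Real.zero_rpow h0.ne', mul_zero, sub_zero] at h2
      exact h2.mono_left nhdsWithin_le_nhds
    refine le_of_tendsto ht ?_
    filter_upwards [Ioo_mem_nhdsGT (show (0:ℝ) < 1 - h by linarith [hh.2])] with e he
    have hx : h + e ∈ Ioo (0:ℝ) 1 := ⟨by linarith [hh.1, he.1], by linarith [he.2]⟩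
    have hy : e ∈ Ioo (0:ℝ) 1 := ⟨he.1, by linarith [hh.1, he.2]⟩
    refine (le_abs_self _).trans (le_csSup ⟨_, hub⟩ ⟨h + e, hx, e, hy, ?_, ?_⟩)
    · rw [add_sub_cancel_right, abs_of_pos hh.1]
    · rw [hg _ hx, hg _ hy]

lemma beta_scaled (α β s : ℝ) (hα : α < 1) (hβ : 0 ≤ β) (hs : 0 < s) :
    ∫ t in (0:ℝ)..s, t ^ β * (s - t) ^ (-α) =
      s ^ (β + 1 - α) * (Real.Gamma (β + 1) * Real.Gamma (1 - α) / Real.Gamma (β + 1 + (1 - α))) := by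
  have h1 := Complex.betaIntegral_scaled ((β + 1 : ℝ) : ℂ) ((1 - α : ℝ) : ℂ) hs
  rw [Complex.betaIntegral_eq_Gamma_mul_div _ _ (by simp; linarith) (by simp; linarith)] at h1
  have h2 : ∫ (x : ℝ) in (0:ℝ)..s, (x:ℂ) ^ (((β + 1 : ℝ) : ℂ) - 1) * ((s:ℂ) - x) ^ (((1 - α : ℝ) : ℂ) - 1)
      = ((∫ t in (0:ℝ)..s, t ^ β * (s - t) ^ (-α) : ℝ) : ℂ) := by
    rw [← intervalIntegral.integral_ofReal]
    apply intervalIntegral.integral_congr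
    intro x hx
    rw [uIcc_of_le hs.le] at hx
    simp only
    push_cast
    rw [Complex.ofReal_cpow hx.1, Complex.ofReal_cpow (sub_nonneg.2 hx.2)]
    push_cast
    congr 2 <;> ring
  rw [h2] at h1
  apply Complex.ofReal_injective
  rw [h1]
  push_cast [Complex.ofReal_cpow hs.le]
  rw [← Complex.Gamma_ofReal, ← Complex.Gamma_ofReal, ← Complex.Gamma_ofReal]
  push_cast
  congr 2
  ring

lemma RL_rpow (α β x : ℝ) (hα : α ∈ Ioo (0:ℝ) 1) (hβ : β ∈ Ioc α 1) (hx : 0 < x) :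
    RLderiv α (fun x => x ^ β) x = Real.Gamma (1 + β) / Real.Gamma (β - α + 1) * x ^ (β - α) := by
  have hβ0 : 0 ≤ β := by linarith [hα.1, hβ.1]
  have h2 := hα.2
  have h3 := hβ.1
  have hd : HasDerivAt (fun s : ℝ => ∫ t in (0:ℝ)..s, t ^ β * (s - t) ^ (-α))
      (((β + 1 - α) * x ^ (β + 1 - α - 1)) *
        (Real.Gamma (β + 1) * Real.Gamma (1 - α) / Real.Gamma (β + 1 + (1 - α)))) x := by
    have := (Real.hasDerivAt_rpow_const (x := x) (p := β + 1 - α) (Or.inl hx.ne')).mul_const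
      (Real.Gamma (β + 1) * Real.Gamma (1 - α) / Real.Gamma (β + 1 + (1 - α)))
    refine this.congr_of_eventuallyEq ?_
    filter_upwards [lt_mem_nhds hx] with s hs
    exact beta_scaled α β s hα.2 hβ0 hs
  unfold RLderiv
  rw [hd.deriv, show β + 1 + (1 - α) = (β - α + 1) + 1 by ring,
    Real.Gamma_add_one (s := β - α + 1) (by linarith), show β + 1 - α - 1 = β - α by ring,
    add_comm 1 β]
  have g1 : Real.Gamma (1 - α) ≠ 0 := (Real.Gamma_pos_of_pos (by linarith)).ne'
  have g2 : Real.Gamma (β - α + 1) ≠ 0 := (Real.Gamma_pos_of_pos (by linarith)).ne'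
  have g3 : β - α + 1 ≠ 0 := by linarith
  field_simp
  ring

lemma rpow_part (α β : ℝ) (hα : α ∈ Ioo (0:ℝ) 1) (hβ : β ∈ Ioc α 1) :
    (fun x : ℝ => x ^ β) ∈ Sset α ∧
      ∀ h ∈ Set.Ioo (0:ℝ) 1,
        omegaOn (Set.Ioo 0 1) (RLderiv α (fun x => x ^ β)) h
            / (∫ t in (0:ℝ)..h, omegaOn (Set.Ioo 0 1) (fun x : ℝ => x ^ β) t * t ^ (-1 - α))
          = Real.Gamma (1 + β) / Real.Gamma (β - α) := by
  have a0 := hα.1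
  have a1 := hα.2
  have b0 := hβ.1
  have b1 := hβ.2
  have hom : ∀ h ∈ Ioo (0:ℝ) 1, ∀ t ∈ Ioc 0 h,
      t ^ (β - 1 - α) = omegaOn (Set.Ioo 0 1) (fun x : ℝ => x ^ β) t * t ^ (-1 - α) := by
    intro h hh t ht
    rw [omegaOn_rpow β (by linarith) b1 t ⟨ht.1, ht.2.trans_lt hh.2⟩ 1 zero_le_one _ (by simp),
      one_mul, ← Real.rpow_add ht.1]
    congr 1; ring
  refine ⟨⟨?_, ?_, ?_⟩, ?_⟩
  · exact (Real.continuous_rpow_const (by linarith)).continuousOn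
  · have := (Real.continuous_rpow_const (q := β) (by linarith)).tendsto 0
    rw [Real.zero_rpow (by linarith)] at this
    exact this.mono_left nhdsWithin_le_nhds
  · intro h hh
    have : IntervalIntegrable (fun t : ℝ => t ^ (β - 1 - α)) volume 0 h :=
      intervalIntegral.intervalIntegrable_rpow' (by linarith)
    refine this.congr ?_
    rw [uIoc_of_le hh.1.le]
    intro t ht
    exact hom h hh t ht
  · intro h hh
    have e : ∫ t in (0:ℝ)..h, omegaOn (Set.Ioo 0 1) (fun x : ℝ => x ^ β) t * t ^ (-1 - α)
        = h ^ (β - α) / (β - α) := by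
      rw [intervalIntegral.integral_of_le hh.1.le,
        ← setIntegral_congr_fun measurableSet_Ioc (hom h hh),
        ← intervalIntegral.integral_of_le hh.1.le, integral_rpow (Or.inl (by linarith)),
        show β - 1 - α + 1 = β - α by ring, Real.zero_rpow (by linarith), sub_zero]
    have gp : 0 < Real.Gamma (β - α) := Real.Gamma_pos_of_pos (by linarith)
    have hp : 0 < h ^ (β - α) := Real.rpow_pos_of_pos hh.1 _
    have bp : 0 < β - α := by linarith
    rw [e, omegaOn_rpow (β - α) (by linarith) (by linarith) h hh
      (Real.Gamma (1 + β) / Real.Gamma (β - α + 1)) ?_ _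
      (fun x hx => RL_rpow α β x hα hβ hx.1), Real.Gamma_add_one bp.ne']
    · field_simp
    · exact div_nonneg (Real.Gamma_pos_of_pos (by linarith)).le (Real.Gamma_pos_of_pos (by linarith)).le

lemma sup_part (α : ℝ) (hα : α ∈ Ioo (0:ℝ) 1) :
    sSup ((fun β => Real.Gamma (1 + β) / Real.Gamma (β - α)) '' Set.Ioc α 1)
        = 1 / Real.Gamma (1 - α) := by
  have a0 := hα.1
  have a1 := hα.2
  apply IsGreatest.csSup_eq
  constructor
  · refine ⟨1, ⟨a1, le_rfl⟩, ?_⟩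
    simp only
    norm_num [Real.Gamma_two]
  · rintro _ ⟨β, hβ, rfl⟩
    have b0 := hβ.1
    have b1 := hβ.2
    have p1 : 0 < Real.Gamma (1 - α) := Real.Gamma_pos_of_pos (by linarith)
    have p2 : 0 < Real.Gamma (β - α) := Real.Gamma_pos_of_pos (by linarith)
    have p3 : 0 < Real.Gamma (1 + β) := Real.Gamma_pos_of_pos (by linarith)
    simp only
    rw [div_le_div_iff₀ p2 p1, one_mul, ← Real.log_le_log_iff (mul_pos p3 p1) p2,
      Real.log_mul p3.ne' p1.ne']
    have hd : 0 < 2 - β + α := by linarith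
    have l0 : 0 ≤ (1 + α) / (2 - β + α) := by positivity
    have l1 : 0 ≤ (1 - β) / (2 - β + α) := div_nonneg (by linarith) hd.le
    have l2 : (1 + α) / (2 - β + α) + (1 - β) / (2 - β + α) = 1 := by
      field_simp; ring
    have c := Real.convexOn_log_Gamma.2
    have c1 := c (x := 2) (y := β - α) (by simp) (by simp; linarith) l0 l1 l2
    have c2 := c (x := 2) (y := β - α) (by simp) (by simp; linarith) l1 l0 (by linarith)
    simp only [smul_eq_mul, Function.comp, Real.Gamma_two, Real.log_one, mul_zero, zero_add] at c1 c2
    have e1 : (1 + α) / (2 - β + α) * 2 + (1 - β) / (2 - β + α) * (β - α) = 1 + β := by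
      field_simp; ring
    have e2 : (1 - β) / (2 - β + α) * 2 + (1 + α) / (2 - β + α) * (β - α) = 1 - α := by
      field_simp; ring
    rw [e1] at c1
    rw [e2] at c2
    have := add_le_add c1 c2
    rw [← add_mul, add_comm ((1 - β) / _), l2, one_mul] at this
    exact this

lemma core_bound_ae (α : ℝ) (F W : ℝ → ℝ) (hW : ∀ x y, |F x - F y| ≤ W |x - y|) (x u : ℝ)
    (hu : 0 < u) : ‖(F x - F (x - u)) * u ^ (-1 - α)‖ ≤ W u * u ^ (-1 - α) := by
  rw [norm_mul, Real.norm_eq_abs, Real.norm_of_nonneg (Real.rpow_nonneg hu.le _)]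
  have := hW x (x - u)
  rw [sub_sub_cancel, abs_of_pos hu] at this
  exact mul_le_mul_of_nonneg_right this (Real.rpow_nonneg hu.le _)

lemma core_integrable (α : ℝ) (F W : ℝ → ℝ) (hFc : Continuous F)
    (hW : ∀ x y, |F x - F y| ≤ W |x - y|)
    (hWi : IntegrableOn (fun t => W t * t ^ (-1 - α)) (Ioi 0)) (x : ℝ) :
    IntegrableOn (fun u => (F x - F (x - u)) * u ^ (-1 - α)) (Ioi 0) := by
  refine Integrable.mono' hWi ?_ ?_
  · exact (Measurable.mul (by fun_prop) (by fun_prop)).aestronglyMeasurable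
  · filter_upwards [ae_restrict_mem measurableSet_Ioi] with u hu
    exact core_bound_ae α F W hW x u hu

lemma core_cont (α : ℝ) (F W : ℝ → ℝ) (hFc : Continuous F)
    (hW : ∀ x y, |F x - F y| ≤ W |x - y|)
    (hWi : IntegrableOn (fun t => W t * t ^ (-1 - α)) (Ioi 0)) :
    Continuous (fun x => ∫ u in Ioi (0:ℝ), (F x - F (x - u)) * u ^ (-1 - α)) := by
  refine continuous_of_dominated (bound := fun u => W u * u ^ (-1 - α)) ?_ ?_ hWi ?_
  · exact fun x => (core_integrable α F W hFc hW hWi x).1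
  · intro x
    filter_upwards [ae_restrict_mem measurableSet_Ioi] with u hu
    exact core_bound_ae α F W hW x u hu
  · exact Filter.Eventually.of_forall fun u => by fun_prop

lemma core_deriv (α : ℝ) (hα : α ∈ Ioo (0:ℝ) 1) (F W : ℝ → ℝ) (hFc : Continuous F)
    (hF0 : ∀ x ≤ 0, F x = 0) (hW : ∀ x y, |F x - F y| ≤ W |x - y|) (hWm : Monotone W)
    (hWi : IntegrableOn (fun t => W t * t ^ (-1 - α)) (Ioi 0)) (y : ℝ) (hy : 0 < y) :
    ∫ x in (0:ℝ)..y, (α * ∫ u in Ioi (0:ℝ), (F x - F (x - u)) * u ^ (-1 - α)) =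
      ∫ u in Ioi (0:ℝ), u ^ (-α) * F (y - u) := by
  have a0 := hα.1
  have a1 := hα.2
  have hii : ∀ a b, IntervalIntegrable F volume a b := fun a b => hFc.intervalIntegrable a b
  have hneg : ∀ z ≤ 0, ∫ t in (0:ℝ)..z, F t = 0 := by
    intro z hz
    rw [intervalIntegral.integral_congr (g := fun _ => (0:ℝ))]
    · simp
    · intro t ht
      rw [uIcc_of_ge hz] at ht
      exact hF0 t ht.2
  set H : ℝ → ℝ := fun u => (∫ t in (0:ℝ)..y, F t) - ∫ t in (0:ℝ)..(y - u), F t with hH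
  have hinner : ∀ u > 0, ∫ x in Ioc 0 y, (F x - F (x - u)) * u ^ (-1 - α) = H u * u ^ (-1 - α) := by
    intro u hu
    rw [← intervalIntegral.integral_of_le hy.le, intervalIntegral.integral_mul_const]
    congr 1
    rw [intervalIntegral.integral_sub (hii _ _)
      ((show Continuous fun x => F (x - u) by fun_prop).intervalIntegrable _ _)]
    rw [intervalIntegral.integral_comp_sub_right (fun t => F t) u, hH]
    simp only
    congr 1
    rw [← intervalIntegral.integral_add_adjacent_intervals (hii (0 - u) 0) (hii 0 (y - u)),
      intervalIntegral.integral_symm, hneg _ (by linarith)]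
    simp
  have hprod : Integrable (Function.uncurry fun x u => (F x - F (x - u)) * u ^ (-1 - α))
      ((volume.restrict (Ioc 0 y)).prod (volume.restrict (Ioi 0))) := by
    refine Integrable.mono' (hWi.comp_snd (volume.restrict (Ioc 0 y))) ?_ ?_
    · apply Measurable.aestronglyMeasurable
      unfold Function.uncurry
      have := hFc.measurable
      exact Measurable.mul (by fun_prop) (by fun_prop)
    · rw [Measure.prod_restrict]
      filter_upwards [ae_restrict_mem (measurableSet_Ioc.prod measurableSet_Ioi)] with p hp
      exact core_bound_ae α F W hW p.1 p.2 hp.2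
  have hHint : IntegrableOn (fun u => H u * u ^ (-1 - α)) (Ioi 0) := by
    refine hprod.integral_prod_right.congr ?_
    filter_upwards [ae_restrict_mem measurableSet_Ioi] with u hu
    exact hinner u hu
  have hFb : ∀ z ≤ y, |F z| ≤ W y := by
    intro z hz
    rcases le_total z 0 with h | h
    · rw [hF0 z h, abs_zero]
      have := (abs_nonneg _).trans (hW y 0)
      rwa [sub_zero, abs_of_pos hy] at this
    · have := hW z 0
      rw [hF0 0 le_rfl, sub_zero, sub_zero, abs_of_nonneg h] at this
      exact this.trans (hWm hz)
  have hHb : ∀ u > 0, |H u| ≤ W y * u := by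
    intro u hu
    have e : H u = ∫ t in (y - u)..y, F t := by
      rw [hH]; simp only
      rw [intervalIntegral.integral_interval_sub_left (hii _ _) (hii _ _)]
    rw [e]
    have := intervalIntegral.norm_integral_le_of_norm_le_const (a := y - u) (b := y) (f := F)
      (C := W y) (fun z hz => by
        rw [uIoc_of_le (by linarith)] at hz
        exact hFb z hz.2)
    rwa [sub_sub_cancel, abs_of_pos hu] at this
  have hHd : ∀ u, HasDerivAt H (F (y - u)) u := by
    intro u
    have h1 : HasDerivAt (fun z => ∫ t in (0:ℝ)..z, F t) (F (y - u)) (y - u) :=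
      (hFc.integral_hasStrictDerivAt 0 (y - u)).hasDerivAt
    have h2 : HasDerivAt (fun u : ℝ => y - u) (-1) u := by
      simpa using (hasDerivAt_id u).const_sub y
    have h3 := (h1.comp u h2).const_sub (∫ t in (0:ℝ)..y, F t)
    simpa using h3
  have hparts := integral_Ioi_mul_deriv_eq_deriv_mul (a := 0) (a' := (0:ℝ)) (b' := (0:ℝ))
    (u := fun u : ℝ => u ^ (-α)) (u' := fun u : ℝ => -α * u ^ (-α - 1))
    (v := H) (v' := fun u => F (y - u))
    (fun u hu => Real.hasDerivAt_rpow_const (Or.inl (ne_of_gt hu)))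
    (fun u _ => hHd u) ?_ ?_ ?_ ?_
  · rw [hparts, intervalIntegral.integral_const_mul, intervalIntegral.integral_of_le hy.le,
      integral_integral_swap hprod, setIntegral_congr_fun measurableSet_Ioi hinner,
      ← integral_const_mul, sub_zero, zero_sub, ← integral_neg]
    congr 1
    ext u
    rw [show -1 - α = -α - 1 by ring]; ring
  · have h1 : IntegrableOn (fun u : ℝ => W y * u ^ (-α)) (Ioc 0 y) := by
      have := (intervalIntegral.intervalIntegrable_rpow' (a := 0) (b := y) (r := -α)
        (by linarith)).const_mul (W y)
      rwa [intervalIntegrable_iff_integrableOn_Ioc_of_le hy.le] at this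
    have h2 : IntegrableOn ((fun u : ℝ => u ^ (-α)) * fun u => F (y - u)) (Ioc 0 y) := by
      refine Integrable.mono' h1 ?_ ?_
      · have := hFc.measurable
        exact (Measurable.mul (by fun_prop) (by fun_prop)).aestronglyMeasurable
      · filter_upwards [ae_restrict_mem measurableSet_Ioc] with u hu
        simp only [Pi.mul_apply]
        rw [norm_mul, mul_comm, Real.norm_of_nonneg (Real.rpow_nonneg hu.1.le _)]
        exact mul_le_mul_of_nonneg_right (hFb _ (by linarith [hu.1])) (Real.rpow_nonneg hu.1.le _)
    have h3 : IntegrableOn ((fun u : ℝ => u ^ (-α)) * fun u => F (y - u)) (Ioi y) := by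
      refine IntegrableOn.congr_fun (f := fun _ => (0:ℝ)) (by simp) ?_ measurableSet_Ioi
      intro u hu
      simp only [Pi.mul_apply]
      rw [hF0 _ (by linarith [mem_Ioi.1 hu]), mul_zero]
    have := h2.union h3
    rwa [Ioc_union_Ioi_eq_Ioi hy.le] at this
  · refine (hHint.const_mul (-α)).congr ?_
    refine Filter.Eventually.of_forall fun u => ?_
    simp only [Pi.mul_apply]
    rw [show -1 - α = -α - 1 by ring]; ring
  · have t1 : Filter.Tendsto (fun u : ℝ => W y * u ^ (1 - α)) (nhdsWithin 0 (Ioi 0)) (nhds 0) := by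
      have := ((Real.continuous_rpow_const (q := 1 - α) (by linarith)).tendsto 0).const_mul (W y)
      rw [Real.zero_rpow (by linarith), mul_zero] at this
      exact this.mono_left nhdsWithin_le_nhds
    refine squeeze_zero_norm' ?_ t1
    filter_upwards [self_mem_nhdsWithin] with u hu
    have hu : 0 < u := hu
    simp only [Pi.mul_apply]
    rw [norm_mul, Real.norm_of_nonneg (Real.rpow_nonneg hu.le _)]
    calc u ^ (-α) * ‖H u‖ ≤ u ^ (-α) * (W y * u) :=
          mul_le_mul_of_nonneg_left (hHb u hu) (Real.rpow_nonneg hu.le _)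
      _ = W y * u ^ (1 - α) := by
          rw [show 1 - α = -α + 1 by ring, Real.rpow_add_one hu.ne']; ring
  · have t1 := (tendsto_rpow_neg_atTop a0).mul_const (∫ t in (0:ℝ)..y, F t)
    rw [zero_mul] at t1
    refine t1.congr' ?_
    filter_upwards [Filter.eventually_ge_atTop y] with u hu
    simp only [Pi.mul_apply, hH]
    rw [hneg (y - u) (by linarith), sub_zero]

lemma core_hasDeriv (α : ℝ) (hα : α ∈ Ioo (0:ℝ) 1) (F W : ℝ → ℝ) (hFc : Continuous F)
    (hF0 : ∀ x ≤ 0, F x = 0) (hW : ∀ x y, |F x - F y| ≤ W |x - y|) (hWm : Monotone W)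
    (hWi : IntegrableOn (fun t => W t * t ^ (-1 - α)) (Ioi 0)) (b : ℝ) (f : ℝ → ℝ)
    (hf : ∀ t ∈ Ioc 0 b, F t = f t) (x : ℝ) (hx : 0 < x) (hxb : x < b) :
    RLderiv α f x = (1 / Real.Gamma (1 - α)) *
      (α * ∫ u in Ioi (0:ℝ), (F x - F (x - u)) * u ^ (-1 - α)) := by
  unfold RLderiv
  congr 1
  have hM := (core_cont α F W hFc hW hWi).const_mul α
  have hd := (hM.integral_hasStrictDerivAt 0 x).hasDerivAt
  refine HasDerivAt.deriv (hd.congr_of_eventuallyEq ?_)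
  filter_upwards [Ioo_mem_nhds hx hxb] with s hs
  rw [core_deriv α hα F W hFc hF0 hW hWm hWi s hs.1]
  have e1 : ∫ t in (0:ℝ)..s, f t * (s - t) ^ (-α) = ∫ t in (0:ℝ)..s, F t * (s - t) ^ (-α) := by
    rw [intervalIntegral.integral_of_le hs.1.le, intervalIntegral.integral_of_le hs.1.le]
    refine setIntegral_congr_fun measurableSet_Ioc fun t ht => ?_
    try simp only
    rw [hf t ⟨ht.1, ht.2.trans hs.2.le⟩]
  have e2 : ∫ t in (0:ℝ)..s, F t * (s - t) ^ (-α) = ∫ u in (0:ℝ)..s, u ^ (-α) * F (s - u) := by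
    have := intervalIntegral.integral_comp_sub_left (a := 0) (b := s)
      (fun u => u ^ (-α) * F (s - u)) s
    simp only [sub_sub_cancel, sub_self, sub_zero] at this
    rw [← this]
    congr 1; ext t; ring
  rw [e1, e2, intervalIntegral.integral_of_le hs.1.le]
  symm
  refine setIntegral_eq_of_subset_of_forall_sdiff_eq_zero measurableSet_Ioi
    Ioc_subset_Ioi_self ?_
  rintro u ⟨hu1, hu2⟩
  have : s < u := by
    by_contra hc
    exact hu2 ⟨hu1, not_lt.1 hc⟩
  rw [hF0 _ (by linarith), mul_zero]

lemma core_diff (α : ℝ) (hα : α ∈ Ioo (0:ℝ) 1) (F W : ℝ → ℝ) (hFc : Continuous F)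
    (hW : ∀ x y, |F x - F y| ≤ W |x - y|) (hWm : Monotone W)
    (hWi : IntegrableOn (fun t => W t * t ^ (-1 - α)) (Ioi 0)) (x y h : ℝ) (hh : 0 < h)
    (hxy : |x - y| ≤ h) :
    |(∫ u in Ioi (0:ℝ), (F x - F (x - u)) * u ^ (-1 - α)) -
      ∫ u in Ioi (0:ℝ), (F y - F (y - u)) * u ^ (-1 - α)| ≤
      2 * (∫ t in (0:ℝ)..h, W t * t ^ (-1 - α)) + 2 * W h * (h ^ (-α) / α) := by
  have a0 := hα.1
  have ix := core_integrable α F W hFc hW hWi x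
  have iy := core_integrable α F W hFc hW hWi y
  have id : IntegrableOn (fun u => (F x - F (x - u)) * u ^ (-1 - α)
      - (F y - F (y - u)) * u ^ (-1 - α)) (Ioi 0) := ix.sub iy
  rw [← integral_sub ix iy, ← Ioc_union_Ioi_eq_Ioi hh.le,
    setIntegral_union (Ioc_disjoint_Ioi le_rfl) measurableSet_Ioi
      (id.mono_set Ioc_subset_Ioi_self)
      (id.mono_set (Ioi_subset_Ioi hh.le))]
  refine (abs_add_le _ _).trans (add_le_add ?_ ?_)
  · rw [intervalIntegral.integral_of_le hh.le, ← integral_const_mul]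
    rw [← Real.norm_eq_abs]
    refine norm_integral_le_of_norm_le ((hWi.mono_set Ioc_subset_Ioi_self).const_mul 2) ?_
    filter_upwards [ae_restrict_mem measurableSet_Ioc] with u hu
    have h1 := core_bound_ae α F W hW x u hu.1
    have h2 := core_bound_ae α F W hW y u hu.1
    refine (norm_sub_le _ _).trans ?_
    linarith
  · have hi : IntegrableOn (fun u : ℝ => u ^ (-1 - α)) (Ioi h) :=
      integrableOn_Ioi_rpow_of_lt (by linarith) hh
    have hv : ∫ u in Ioi h, u ^ (-1 - α) = h ^ (-α) / α := by
      rw [integral_Ioi_rpow_of_lt (by linarith) hh, show -1 - α + 1 = -α by ring, neg_div_neg_eq]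
    rw [← hv, ← integral_const_mul]
    rw [← Real.norm_eq_abs]
    refine norm_integral_le_of_norm_le (hi.const_mul _) ?_
    filter_upwards [ae_restrict_mem measurableSet_Ioi] with u hu
    have hu0 : 0 < u := hh.trans hu
    rw [← sub_mul, norm_mul, Real.norm_of_nonneg (Real.rpow_nonneg hu0.le _)]
    refine mul_le_mul_of_nonneg_right ?_ (Real.rpow_nonneg hu0.le _)
    have h1 := (hW x y).trans (hWm hxy)
    have h2 := hW (x - u) (y - u)
    rw [sub_sub_sub_cancel_right] at h2
    have h3 := h2.trans (hWm hxy)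
    rw [Real.norm_eq_abs]
    rw [abs_le] at *
    constructor <;> linarith [h1.1, h1.2, h3.1, h3.2]

lemma om_nonneg (f : ℝ → ℝ) (t : ℝ) : 0 ≤ omegaOn (Ioo 0 1) f t := by
  apply Real.sSup_nonneg
  rintro v ⟨x, _, y, _, _, rfl⟩
  exact abs_nonneg _

lemma om_double (f : ℝ → ℝ) (t C : ℝ)
    (hC : ∀ x ∈ Ioo (0:ℝ) 1, ∀ y ∈ Ioo (0:ℝ) 1, |x - y| ≤ t → |f x - f y| ≤ C) :
    ∀ x ∈ Ioo (0:ℝ) 1, ∀ y ∈ Ioo (0:ℝ) 1, |x - y| ≤ 2 * t → |f x - f y| ≤ 2 * C := by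
  intro x hx y hy hxy
  rw [abs_le] at hxy
  have hm : (x + y) / 2 ∈ Ioo (0:ℝ) 1 := ⟨by linarith [hx.1, hy.1], by linarith [hx.2, hy.2]⟩
  have h1 := hC x hx _ hm (by rw [abs_le]; constructor <;> linarith [hxy.1, hxy.2])
  have h2 := hC _ hm y hy (by rw [abs_le]; constructor <;> linarith [hxy.1, hxy.2])
  have := abs_sub_le (f x) (f ((x + y) / 2)) (f y)
  linarith

lemma om_bdd (f : ℝ → ℝ) (t C : ℝ) (ht : 0 < t)
    (hC : ∀ x ∈ Ioo (0:ℝ) 1, ∀ y ∈ Ioo (0:ℝ) 1, |x - y| ≤ t → |f x - f y| ≤ C) :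
    ∃ C', ∀ x ∈ Ioo (0:ℝ) 1, ∀ y ∈ Ioo (0:ℝ) 1, |f x - f y| ≤ C' := by
  have hn : ∀ n : ℕ, ∀ x ∈ Ioo (0:ℝ) 1, ∀ y ∈ Ioo (0:ℝ) 1, |x - y| ≤ 2 ^ n * t →
      |f x - f y| ≤ 2 ^ n * C := by
    intro n
    induction n with
    | zero => simpa using hC
    | succ n ih =>
      have := om_double f _ _ ih
      intro x hx y hy hxy
      have := this x hx y hy (by rw [pow_succ] at hxy; linarith)
      rw [pow_succ]; linarith
  obtain ⟨n, hn2⟩ := pow_unbounded_of_one_lt (1 / t) (one_lt_two (α := ℝ))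
  refine ⟨2 ^ n * C, fun x hx y hy => hn n x hx y hy ?_⟩
  rw [div_lt_iff₀ ht] at hn2
  rw [abs_le]
  constructor <;> linarith [hx.1, hx.2, hy.1, hy.2]

lemma ratio_bound (α : ℝ) (hα : α ∈ Ioo (0:ℝ) 1) (h : ℝ) (hh : h ∈ Ioo (0:ℝ) 1) (f : ℝ → ℝ)
    (hf : f ∈ Sset α) :
    omegaOn (Set.Ioo 0 1) (RLderiv α f) h
          / (∫ t in (0:ℝ)..h, omegaOn (Set.Ioo 0 1) f t * t ^ (-1 - α)) ≤
      1 / Real.Gamma (1 - α) * (2 * α + 8) := by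
  have a0 := hα.1
  have a1 := hα.2
  have gp : 0 < Real.Gamma (1 - α) := Real.Gamma_pos_of_pos (by linarith)
  have Cp : 0 ≤ 1 / Real.Gamma (1 - α) * (2 * α + 8) := by positivity
  by_cases hb : ∃ C', ∀ x ∈ Ioo (0:ℝ) 1, ∀ y ∈ Ioo (0:ℝ) 1, |f x - f y| ≤ C'
  swap
  · have hz : ∀ t ∈ Ioc 0 h, omegaOn (Ioo 0 1) f t * t ^ (-1 - α) = (fun _ => (0:ℝ)) t := by
      intro t ht
      have : omegaOn (Ioo 0 1) f t = 0 := by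
        apply Real.sSup_of_not_bddAbove
        rintro ⟨C, hC⟩
        exact hb (om_bdd f t C ht.1 fun x hx y hy hxy => hC ⟨x, hx, y, hy, hxy, rfl⟩)
      rw [this, zero_mul]
    rw [intervalIntegral.integral_of_le hh.1.le, setIntegral_congr_fun measurableSet_Ioc hz]
    simpa using Cp
  obtain ⟨B, hB⟩ := hb
  obtain ⟨hfc, hf0, hfi⟩ := hf
  set W : ℝ → ℝ := omegaOn (Ioo 0 1) f with hWdef
  have hWbd : ∀ t, BddAbove {v | ∃ x ∈ Ioo (0:ℝ) 1, ∃ y ∈ Ioo (0:ℝ) 1, |x - y| ≤ t ∧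
      v = |f x - f y|} := by
    intro t
    refine ⟨B, ?_⟩
    rintro v ⟨x, hx, y, hy, _, rfl⟩
    exact hB x hx y hy
  have hW0 : ∀ t, 0 ≤ W t := om_nonneg f
  have hWle : ∀ t, ∀ x ∈ Ioo (0:ℝ) 1, ∀ y ∈ Ioo (0:ℝ) 1, |x - y| ≤ t → |f x - f y| ≤ W t :=
    fun t x hx y hy hxy => le_csSup (hWbd t) ⟨x, hx, y, hy, hxy, rfl⟩
  have hWm : Monotone W := by
    intro s t hst
    refine Real.sSup_le ?_ (hW0 t)
    rintro v ⟨x, hx, y, hy, hxy, rfl⟩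
    exact hWle t x hx y hy (hxy.trans hst)
  have hB0 : 0 ≤ B := (abs_nonneg _).trans (hB (1/2) (by norm_num) (1/2) (by norm_num))
  have hWB : ∀ t, W t ≤ B := by
    intro t
    refine Real.sSup_le ?_ hB0
    rintro v ⟨x, hx, y, hy, hxy, rfl⟩
    exact hB x hx y hy
  have hWd : ∀ t, W (2 * t) ≤ 2 * W t := by
    intro t
    refine Real.sSup_le ?_ (by linarith [hW0 t])
    rintro v ⟨x, hx, y, hy, hxy, rfl⟩
    exact om_double f t _ (hWle t) x hx y hy hxy
  have hWi : IntegrableOn (fun t => W t * t ^ (-1 - α)) (Ioi 0) := by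
    have h1 := hfi h hh
    rw [intervalIntegrable_iff_integrableOn_Ioc_of_le hh.1.le] at h1
    have h2 : IntegrableOn (fun t => W t * t ^ (-1 - α)) (Ioi h) := by
      refine Integrable.mono' ((integrableOn_Ioi_rpow_of_lt (a := -1 - α) (by linarith)
        hh.1).const_mul B) ?_ ?_
      · have := hWm.measurable
        exact (Measurable.mul (by fun_prop) (by fun_prop)).aestronglyMeasurable
      · filter_upwards [ae_restrict_mem measurableSet_Ioi] with u hu
        have hu0 : 0 < u := hh.1.trans hu
        rw [norm_mul, Real.norm_of_nonneg (Real.rpow_nonneg hu0.le _),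
          Real.norm_of_nonneg (hW0 u)]
        exact mul_le_mul_of_nonneg_right (hWB u) (Real.rpow_nonneg hu0.le _)
    have := h1.union h2
    rwa [Ioc_union_Ioi_eq_Ioi hh.1.le] at this
  set J := ∫ t in (0:ℝ)..h, W t * t ^ (-1 - α) with hJ
  have hJ0 : 0 ≤ J := intervalIntegral.integral_nonneg hh.1.le fun t ht =>
    mul_nonneg (hW0 t) (Real.rpow_nonneg ht.1 _)
  have hWJ : W h * h ^ (-α) ≤ 4 * J := by
    have hp := hh.1
    have e1 : ∫ t in (h/2)..h, (W h / 2 * h ^ (-1 - α)) ≤ ∫ t in (h/2)..h, W t * t ^ (-1 - α) := by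
      refine intervalIntegral.integral_mono_on (by linarith) (by simp) ?_ ?_
      · rw [intervalIntegrable_iff_integrableOn_Ioc_of_le (by linarith)]
        exact hWi.mono_set fun t ht => (half_pos hp).trans ht.1
      · intro t ht
        have ht0 : 0 < t := by linarith [ht.1]
        have w1 := hWd (h/2)
        rw [mul_div_cancel₀ h two_ne_zero] at w1
        have w2 := hWm ht.1
        refine mul_le_mul (by linarith) ?_ (Real.rpow_nonneg hp.le _) (hW0 t)
        exact Real.rpow_le_rpow_of_nonpos ht0 ht.2 (by linarith)
    have e2 : ∫ t in (h/2)..h, W t * t ^ (-1 - α) ≤ J := by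
      rw [hJ, intervalIntegral.integral_of_le hp.le, intervalIntegral.integral_of_le (by linarith)]
      refine setIntegral_mono_set (hWi.mono_set Ioc_subset_Ioi_self) ?_ ?_
      · filter_upwards [ae_restrict_mem measurableSet_Ioc] with u hu
        exact mul_nonneg (hW0 u) (Real.rpow_nonneg hu.1.le _)
      · exact (Ioc_subset_Ioc_left (by linarith)).eventuallyLE
    rw [intervalIntegral.integral_const, smul_eq_mul] at e1
    have e3 : h ^ (-α) = h ^ (-1 - α) * h := by
      rw [← Real.rpow_add_one hp.ne']; congr 1; ring
    rw [e3]
    nlinarith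
  refine div_le_of_le_mul₀ hJ0 Cp ?_
  refine Real.sSup_le ?_ (mul_nonneg Cp hJ0)
  rintro v ⟨x, hx, y, hy, hxy, rfl⟩
  obtain ⟨b, hb1, hb2⟩ := exists_between (max_lt hx.2 hy.2)
  have hxb : x < b := (le_max_left _ _).trans_lt hb1
  have hyb : y < b := (le_max_right _ _).trans_lt hb1
  have hb0 : 0 < b := hx.1.trans hxb
  set F : ℝ → ℝ := fun z => if z ≤ 0 then 0 else f (min z b) with hF
  have hmin : ∀ z > 0, min z b ∈ Ioo (0:ℝ) 1 := fun z hz =>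
    ⟨lt_min hz hb0, (min_le_right _ _).trans_lt hb2⟩
  have hF0 : ∀ z ≤ 0, F z = 0 := fun z hz => if_pos hz
  have hFp : ∀ z > 0, F z = f (min z b) := fun z hz => if_neg (not_le.2 hz)
  have hFc : Continuous F := by
    rw [continuous_iff_continuousAt]
    intro z
    rcases lt_trichotomy z 0 with hz | hz | hz
    · refine (continuousAt_const (y := (0:ℝ))).congr ?_
      filter_upwards [gt_mem_nhds hz] with w hw
      exact (hF0 w hw.le).symm
    · subst hz
      rw [continuousAt_iff_continuous_left'_right']
      constructor
      · have : Filter.Tendsto (fun _ : ℝ => (0:ℝ)) (nhdsWithin 0 (Iio 0)) (nhds 0) :=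
          tendsto_const_nhds
        unfold ContinuousWithinAt
        rw [hF0 0 le_rfl]
        refine this.congr' ?_
        filter_upwards [self_mem_nhdsWithin] with w hw
        exact (hF0 w (le_of_lt hw)).symm
      · unfold ContinuousWithinAt
        rw [hF0 0 le_rfl]
        refine hf0.congr' ?_
        filter_upwards [Ioo_mem_nhdsGT hb0] with w hw
        rw [hFp w hw.1, min_eq_left hw.2.le]
    · have h1 : ContinuousAt (fun w => f (min w b)) z := by
        have h2 : ContinuousAt f (min z b) := hfc.continuousAt (isOpen_Ioo.mem_nhds (hmin z hz))
        exact ContinuousAt.comp (f := fun w => min w b) h2 (by fun_prop)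
      refine h1.congr ?_
      filter_upwards [lt_mem_nhds hz] with w hw
      exact (hFp w hw).symm
  have hfW : ∀ m ∈ Ioo (0:ℝ) 1, |f m| ≤ W m := by
    intro m hm
    have ht : Filter.Tendsto (fun e => |f m - f e|) (nhdsWithin 0 (Ioi 0)) (nhds |f m - 0|) :=
      (hf0.const_sub (f m)).abs
    rw [sub_zero] at ht
    refine le_of_tendsto ht ?_
    filter_upwards [Ioo_mem_nhdsGT hm.1] with e he
    refine hWle m m hm e ⟨he.1, he.2.trans hm.2⟩ ?_
    rw [abs_le]; constructor <;> linarith [he.1, he.2]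
  have hFW0 : ∀ z w, z ≤ 0 → |F w - F z| ≤ W |w - z| := by
    intro z w hz
    rw [hF0 z hz, sub_zero]
    rcases le_or_gt w 0 with hw | hw
    · rw [hF0 w hw, abs_zero]; exact hW0 _
    · rw [hFp w hw]
      refine (hfW _ (hmin w hw)).trans (hWm ?_)
      rw [abs_of_pos (by linarith)]
      linarith [min_le_left w b]
  have hFW : ∀ z w, |F z - F w| ≤ W |z - w| := by
    intro z w
    rcases le_or_gt z 0 with hz | hz
    · rw [abs_sub_comm, abs_sub_comm z w]; exact hFW0 z w hz
    rcases le_or_gt w 0 with hw | hw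
    · exact hFW0 w z hw
    rw [hFp z hz, hFp w hw]
    refine hWle _ _ (hmin z hz) _ (hmin w hw) ?_
    have := abs_min_sub_min_le_max z b w b
    simpa using this
  have hfF : ∀ t ∈ Ioc 0 b, F t = f t := fun t ht => by rw [hFp t ht.1, min_eq_left ht.2]
  rw [core_hasDeriv α hα F W hFc hF0 hFW hWm hWi b f hfF x hx.1 hxb,
    core_hasDeriv α hα F W hFc hF0 hFW hWm hWi b f hfF y hy.1 hyb, ← mul_sub, ← mul_sub,
    abs_mul, abs_mul, abs_of_pos (one_div_pos.2 gp), abs_of_pos a0, mul_assoc]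
  refine mul_le_mul_of_nonneg_left ?_ (one_div_pos.2 gp).le
  have hd := core_diff α hα F W hFc hFW hWm hWi x y h hh.1 hxy
  refine (mul_le_mul_of_nonneg_left hd a0.le).trans ?_
  have e : α * (2 * J + 2 * W h * (h ^ (-α) / α)) = 2 * α * J + 2 * (W h * h ^ (-α)) := by
    field_simp
  rw [e]
  linarith

theorem KD_lower_bound (α : ℝ) (hα : α ∈ Set.Ioo (0:ℝ) 1) :
    1 / Real.Gamma (1 - α) ≤ KD α ∧
    (∀ β ∈ Set.Ioc α 1,
      (fun x : ℝ => x ^ β) ∈ Sset α ∧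
      ∀ h ∈ Set.Ioo (0:ℝ) 1,
        omegaOn (Set.Ioo 0 1) (RLderiv α (fun x => x ^ β)) h
            / (∫ t in (0:ℝ)..h, omegaOn (Set.Ioo 0 1) (fun x : ℝ => x ^ β) t * t ^ (-1 - α))
          = Real.Gamma (1 + β) / Real.Gamma (β - α)) ∧
    sSup ((fun β => Real.Gamma (1 + β) / Real.Gamma (β - α)) '' Set.Ioc α 1)
        = 1 / Real.Gamma (1 - α) := by
  refine ⟨?_, fun β hβ => rpow_part α β hα hβ, sup_part α hα⟩
  refine le_csSup ⟨1 / Real.Gamma (1 - α) * (2 * α + 8), ?_⟩ ?_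
  · rintro r ⟨h, hh, f, hf, _, rfl⟩
    exact ratio_bound α hα h hh f hf
  · have h1 := rpow_part α 1 hα ⟨hα.2, le_rfl⟩
    refine ⟨1 / 2, by norm_num, _, h1.1, ?_, ?_⟩
    · rintro ⟨c, hc⟩
      have e1 := hc (1 / 2) (by norm_num)
      have e2 := hc (1 / 4) (by norm_num)
      simp only [Real.rpow_one] at e1 e2
      linarith
    · rw [h1.2 (1 / 2) (by norm_num)]
      norm_num [Real.Gamma_two]
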